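/- Let n ≥ 2 be an integer and let a ∈ ℂ with a ∉ ℤ. Then ζ(n,a) + (−1)^n ζ(n,1−a) = ((−1)^{n−1} π/(n−1)!) · d^{n−1}/da^{n−1} cot(πa), where ζ(s,a) = Σ_{m=0}^∞ 1/(a+m)^s is the Hurwitz zeta function and d^{n−1}/da^{n−1} is the (n−1)-st complex derivative with respect to a. -/

import Mathlib

open Real

lemma summable_int_one_div_add_pow {k : ℕ} (hk : 2 ≤ k) (z : ℂ) :
    Summable fun m : ℤ ↦ 1 / (z + m) ^ k :=
  (EisensteinSeries.linear_right_summable z 1 (k := k) (by exact_mod_cast hk)).congr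
    fun m ↦ by simp

lemma differentiableOn_tsum_int_one_div_add_pow {k : ℕ} (hk : 2 ≤ k) :
    DifferentiableOn ℂ (fun z : ℂ ↦ ∑' m : ℤ, 1 / (z + m) ^ k) Complex.integerComplement := by
  intro z hz
  obtain ⟨ε, hε, hball⟩ := Metric.isOpen_iff.mp Complex.isOpen_compl_range_intCast z hz
  have norm_ge (m : ℤ) : ε ≤ ‖z + m‖ := by
    by_contra! h
    have hmem : ((-m : ℤ) : ℂ) ∈ Metric.ball z ε := by
      rw [Metric.mem_ball, dist_comm, dist_eq_norm]
      simpa using h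
    exact hball hmem ⟨-m, rfl⟩
  have hs : Summable fun m : ℤ ↦ 2 ^ k * ‖1 / (z + m) ^ k‖ :=
    (summable_int_one_div_add_pow hk z).norm.mul_left _
  have hd : DifferentiableOn ℂ (fun z : ℂ ↦ ∑' m : ℤ, 1 / (z + m) ^ k)
      (Metric.ball z (ε / 2)) := by
    refine Complex.differentiableOn_tsum_of_summable_norm hs (fun m w hw ↦ ?_)
      Metric.isOpen_ball fun m w hw ↦ ?_
    · have hw' := hball (Metric.ball_subset_ball (by linarith) hw)
      have := pow_ne_zero k (Complex.integerComplement_add_ne_zero hw' m)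
      exact DifferentiableAt.differentiableWithinAt (by fun_prop (disch := exact this))
    · have hzm := norm_ge m
      have hle : ‖z + m‖ / 2 ≤ ‖w + m‖ := by
        have h1 : ‖z + m‖ ≤ ‖w + m‖ + ‖w - z‖ := by
          simpa [add_comm] using norm_sub_le (w + m) (w - z)
        have h2 : ‖w - z‖ < ε / 2 := by simpa [dist_eq_norm] using hw
        linarith
      have hpos : 0 < ‖z + m‖ / 2 := by linarith
      calc ‖1 / (w + m) ^ k‖ = (‖w + m‖ ^ k)⁻¹ := by simp
        _ ≤ ((‖z + m‖ / 2) ^ k)⁻¹ := by gcongr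
        _ = 2 ^ k * ‖1 / (z + m) ^ k‖ := by
          rw [div_pow, inv_div, norm_div, norm_one, norm_pow, mul_one_div]
  exact (hd.differentiableAt (Metric.ball_mem_nhds z (by linarith))).differentiableWithinAt

lemma isPreconnected_integerComplement : IsPreconnected Complex.integerComplement :=
  ((Set.countable_range _).isPathConnected_compl_of_one_lt_rank
    (by simp)).isConnected.isPreconnected

lemma differentiableOn_cot_pi_mul :
    DifferentiableOn ℂ (fun w : ℂ ↦ Complex.cot (π * w)) Complex.integerComplement := by
  have hd : DifferentiableOn ℂ (fun w : ℂ ↦ Complex.cos (π * w) / Complex.sin (π * w))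
      Complex.integerComplement :=
    DifferentiableOn.div (by fun_prop) (by fun_prop) fun z hz ↦ sin_pi_mul_ne_zero hz
  exact hd

/-- The Mittag-Leffler expansion of the iterated derivatives of `π cot (π z)`, on all of `ℂ ∖ ℤ`. -/
lemma eqOn_pi_mul_iteratedDeriv_cot {k : ℕ} (hk : 1 ≤ k) :
    Set.EqOn (fun z ↦ π * iteratedDeriv k (fun w : ℂ ↦ Complex.cot (π * w)) z)
      (fun z ↦ (-1) ^ k * k.factorial * ∑' m : ℤ, 1 / (z + m) ^ (k + 1))
      Complex.integerComplement := by
  have hopen : IsOpen Complex.integerComplement := Complex.isOpen_compl_range_intCast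
  have hcot := differentiableOn_cot_pi_mul.analyticOnNhd hopen
  refine AnalyticOnNhd.eqOn_of_preconnected_of_eventuallyEq (𝕜 := ℂ) (z₀ := Complex.I)
    ?_ ?_ isPreconnected_integerComplement
    (UpperHalfPlane.coe_mem_integerComplement UpperHalfPlane.I) ?_
  · simp_rw [iteratedDeriv_eq_iterate]
    exact analyticOnNhd_const.mul (hcot.iterated_deriv k)
  · exact ((differentiableOn_tsum_int_one_div_add_pow (by lia)).const_mul _).analyticOnNhd hopen
  · filter_upwards [UpperHalfPlane.isOpen_upperHalfPlaneSet.mem_nhds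
      (show Complex.I ∈ UpperHalfPlane.upperHalfPlaneSet by
        simp [UpperHalfPlane.upperHalfPlaneSet])] with z hz
    rw [← iteratedDerivWithin_cot_pi_mul_eq_mul_tsum_div_pow hk hz,
      iteratedDerivWithin_of_isOpen UpperHalfPlane.isOpen_upperHalfPlaneSet hz,
      iteratedDeriv_const_mul_field]

lemma tsum_int_one_div_add_pow {k : ℕ} (hk : 2 ≤ k) (a : ℂ) :
    ∑' m : ℤ, 1 / (a + m) ^ k =
      ∑' m : ℕ, 1 / (a + m) ^ k + (-1) ^ k * ∑' m : ℕ, 1 / ((1 - a) + m) ^ k := by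
  have hs := summable_int_one_div_add_pow hk a
  have hnat : Summable fun m : ℕ ↦ 1 / (a + ((m : ℤ) : ℂ)) ^ k :=
    hs.comp_injective Nat.cast_injective
  have hneg : Summable fun m : ℕ ↦ 1 / (a + ((-((m : ℤ) + 1) : ℤ) : ℂ)) ^ k :=
    hs.comp_injective (i := fun m : ℕ ↦ -((m : ℤ) + 1)) fun m n h ↦ by simpa using h
  rw [tsum_of_nat_of_neg_add_one (f := fun m : ℤ ↦ 1 / (a + m) ^ k) hnat hneg, ← tsum_mul_left]
  congr 1
  refine tsum_congr fun m ↦ ?_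
  have hsign : (((-1 : ℂ) ^ k))⁻¹ = (-1) ^ k := by rw [← inv_pow]; norm_num
  rw [show a + ((-((m : ℤ) + 1) : ℤ) : ℂ) = -1 * (1 - a + m) by push_cast; ring, mul_pow,
    one_div, mul_inv, hsign, one_div]

/-- Reflection property of the Hurwitz zeta function: for an integer `n ≥ 2` and `a ∉ ℤ`,
`ζ(n,a) + (−1)^n ζ(n,1−a) = ((−1)^{n−1} π/(n−1)!) · d^{n−1}/da^{n−1} cot(πa)`,
where `ζ(n,a) = Σ_{m=0}^∞ 1/(a+m)^n`. -/
theorem hurwitzZeta_reflection (n : ℕ) (hn : 2 ≤ n) (a : ℂ) (ha : ∀ m : ℤ, a ≠ (m : ℂ)) :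
    (∑' m : ℕ, 1 / (a + (m : ℂ)) ^ n) +
      (-1 : ℂ) ^ n * (∑' m : ℕ, 1 / ((1 - a) + (m : ℂ)) ^ n) =
      ((-1 : ℂ) ^ (n - 1) * (π : ℂ) / (Nat.factorial (n - 1) : ℂ)) *
        iteratedDeriv (n - 1) (fun w : ℂ => Complex.cot ((π : ℂ) * w)) a := by
  obtain ⟨k, rfl⟩ : ∃ k, n = k + 1 := ⟨n - 1, by lia⟩
  have haZ : a ∈ Complex.integerComplement := fun ⟨m, hm⟩ ↦ ha m hm.symm
  have h := eqOn_pi_mul_iteratedDeriv_cot (k := k) (by lia) haZ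
  have hfac : (k.factorial : ℂ) ≠ 0 := by exact_mod_cast k.factorial_ne_zero
  have hsign : ((-1 : ℂ) ^ k) * (-1) ^ k = 1 := by rw [← mul_pow]; simp
  simp only at h
  rw [← tsum_int_one_div_add_pow hn, Nat.add_sub_cancel, div_mul_eq_mul_div, mul_assoc, h,
    eq_div_iff hfac]
  linear_combination (-(k.factorial : ℂ) * ∑' m : ℤ, 1 / (a + m) ^ (k + 1)) * hsign
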